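/- (Universality of Tessellated Kernels with positive definite parameter) Let a, b, δ ∈ ℝ^n with a < b and δ > 0 componentwise, X := [a,b], Y := [a−δ, b+δ]. For d ∈ ℕ let Z_d(z,x) denote the vector of all monomials in (z,x) ∈ ℝ^{2n} of degree at most d, let 𝟙(z) = 1 if z ≥ 0 componentwise and 0 otherwise, and let N_T^d(z,x) := [Z_d(z,x)𝟙(z−x); Z_d(z,x)(1−𝟙(z−x))], ordered so that the first entry of Z_d is the constant monomial 1. If P is a positive definite matrix of the appropriate size, then the kernel k(x,y) := ∫_Y N_T^d(z,x)ᵀ P N_T^d(z,y) dz is universal on X: k is continuous and the linear span of {x ↦ k(x,y) : y ∈ X} is dense in C(X) with the uniform norm. -/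

import Mathlib

open MeasureTheory Matrix

/-- Functions `⟪φ ·, h⟫` are uniformly approximated by combinations of the kernel sections
`⟪φ ·, φ y⟫` with `y ∈ s`, if the feature map `φ` is bounded on `s`. -/
theorem exists_sum_inner_feature_near {α H : Type*} [NormedAddCommGroup H]
    [InnerProductSpace ℝ H] [CompleteSpace H] (φ : α → H) (s : Set α) (C : ℝ)
    (hC : ∀ x ∈ s, ‖φ x‖ ≤ C) (h : H) (ε : ℝ) (hε : 0 < ε) :
    ∃ (M : ℕ) (c : Fin M → ℝ) (y : Fin M → α), (∀ j, y j ∈ s) ∧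
      ∀ x ∈ s, |inner ℝ (φ x) h - ∑ j, c j * inner ℝ (φ x) (φ (y j))| ≤ ε := by
  set V := (Submodule.span ℝ (φ '' s)).topologicalClosure
  have : CompleteSpace V := (Submodule.isClosed_topologicalClosure _).completeSpace_coe
  have hp : V.starProjection h ∈ closure (Submodule.span ℝ (φ '' s) : Set H) :=
    (V.starProjection_apply_mem h)
  have hC' : 0 < |C| + 1 := by positivity
  obtain ⟨w, hw, hdist⟩ := Metric.mem_closure_iff.1 hp (ε / (|C| + 1)) (by positivity)
  obtain ⟨M, c, g, rfl⟩ := Submodule.mem_span_set'.1 hw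
  choose y hy hyg using fun j => (g j).2
  refine ⟨M, c, y, hy, fun x hx => ?_⟩
  have hxV : φ x ∈ V :=
    Submodule.le_topologicalClosure _ (Submodule.subset_span ⟨x, hx, rfl⟩)
  have h1 : inner ℝ (φ x) h = inner ℝ (φ x) (V.starProjection h) := by
    rw [← sub_eq_zero, ← inner_sub_right]
    exact V.sub_starProjection_mem_orthogonal h _ hxV
  have h2 : ∑ j, c j * inner ℝ (φ x) (φ (y j)) = inner ℝ (φ x) (∑ j, c j • (g j : H)) := by
    simp [inner_sum, inner_smul_right, hyg]
  rw [h1, h2, ← inner_sub_right]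
  rw [dist_eq_norm] at hdist
  calc _ ≤ ‖φ x‖ * _ := abs_real_inner_le_norm _ _
    _ ≤ (|C| + 1) * (ε / (|C| + 1)) := by
      gcongr
      linarith [hC x hx, le_abs_self C]
    _ = ε := by field_simp

/-- Weierstrass approximation by multivariate polynomials on a compact set. -/
theorem exists_mvPolynomial_near_of_continuousOn {ι : Type*} {K : Set (ι → ℝ)}
    (hK : IsCompact K) {g : (ι → ℝ) → ℝ} (hg : ContinuousOn g K) {ε : ℝ} (hε : 0 < ε) :
    ∃ p : MvPolynomial ι ℝ, ∀ x ∈ K, |g x - MvPolynomial.eval x p| ≤ ε := by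
  have := isCompact_iff_compactSpace.1 hK
  let ev : MvPolynomial ι ℝ →ₐ[ℝ] C(K, ℝ) :=
    MvPolynomial.aeval fun i =>
      ⟨fun x : K => x.1 i, (continuous_apply i).comp continuous_subtype_val⟩
  have hev : ∀ p (x : K), ev p x = MvPolynomial.eval x.1 p := by
    intro p x
    induction p using MvPolynomial.induction_on with
    | C r => simp [ev, algebraMap_apply]
    | add p q hp hq => simp [hp, hq]
    | mul_X p i hp => rw [map_mul, map_mul, ContinuousMap.mul_apply, hp]; simp [ev]
  have hsep : ev.range.SeparatesPoints := by
    intro x y hxy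
    obtain ⟨i, hi⟩ := Function.ne_iff.1 (Subtype.coe_injective.ne hxy)
    exact ⟨_, ⟨_, ⟨MvPolynomial.X i, rfl⟩, rfl⟩, by simpa [hev] using hi⟩
  obtain ⟨⟨_, p, rfl⟩, hp⟩ :=
    ContinuousMap.exists_mem_subalgebra_near_continuous_of_separatesPoints ev.range hsep
      (K.domRestrict g) hg.domRestrict ε hε
  refine ⟨p, fun x hx => ?_⟩
  have := hp ⟨x, hx⟩
  rw [abs_sub_comm, ← hev p ⟨x, hx⟩]
  exact this.le

/-- The power `x ^ k` is, for `x ≤ b`, the integral over `[x, b + δ]` of a bounded function. -/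
theorem exists_integral_Icc_eq_pow (a b δ : ℝ) (hδ : 0 < δ) (k : ℕ) :
    ∃ f : ℝ → ℝ, Measurable f ∧ (∃ K, ∀ t ∈ Set.Icc (a - δ) (b + δ), |f t| ≤ K) ∧
      ∀ x ≤ b, ∫ t in Set.Icc x (b + δ), f t = x ^ k := by
  set c := (b + δ) ^ k / δ with hc
  refine ⟨fun t => (Set.Ioi b).indicator (fun _ => c) t - k * t ^ (k - 1), ?_, ?_, ?_⟩
  · exact (measurable_const.indicator measurableSet_Ioi).sub (by fun_prop)
  · obtain ⟨K, hK⟩ := (isCompact_Icc (a := a - δ) (b := b + δ)).exists_bound_of_continuousOn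
      (f := fun t : ℝ => (k : ℝ) * t ^ (k - 1)) (by fun_prop)
    refine ⟨|c| + K, fun t ht => (abs_sub _ _).trans (add_le_add ?_ (hK t ht))⟩
    by_cases h : t ∈ Set.Ioi b <;> simp [h]
  · intro x hx
    have hxb : x ≤ b + δ := by linarith
    rw [integral_sub, integral_indicator measurableSet_Ioi,
      Measure.restrict_restrict measurableSet_Ioi]
    · have h1 : Set.Ioi b ∩ Set.Icc x (b + δ) = Set.Ioc b (b + δ) := by
        ext t
        simp only [Set.mem_inter_iff, Set.mem_Ioi, Set.mem_Icc, Set.mem_Ioc]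
        constructor
        · rintro ⟨h, -, h'⟩; exact ⟨h, h'⟩
        · rintro ⟨h, h'⟩; exact ⟨h, by linarith, h'⟩
      have h2 : ∫ t in Set.Icc x (b + δ), (k : ℝ) * t ^ (k - 1) = (b + δ) ^ k - x ^ k := by
        rw [integral_Icc_eq_integral_Ioc, ← intervalIntegral.integral_of_le hxb]
        exact intervalIntegral.integral_eq_sub_of_hasDerivAt (f := fun t => t ^ k)
          (fun t _ => hasDerivAt_pow k t) (Continuous.intervalIntegrable (by fun_prop) _ _)
      rw [h1, h2, setIntegral_const, Real.volume_real_Ioc_of_le (by linarith), hc, smul_eq_mul]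
      field_simp
      ring
    · exact (integrable_const c).indicator measurableSet_Ioi
    · exact (Continuous.continuousOn (by fun_prop)).integrableOn_compact isCompact_Icc

/-- Every polynomial is, on `[a, b]`, of the form `x ↦ ∫_{[a-δ, b+δ]} 𝟙(z - x) f(z) dz` with `f`
bounded and measurable. -/
theorem exists_integral_orthant_eq_eval {n : ℕ} (a b δ : Fin n → ℝ) (hδ : ∀ i, 0 < δ i)
    (p : MvPolynomial (Fin n) ℝ) :
    ∃ f : (Fin n → ℝ) → ℝ, Measurable f ∧
      (∃ K, ∀ z ∈ Set.Icc (a - δ) (b + δ), |f z| ≤ K) ∧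
      ∀ x ∈ Set.Icc a b, ∫ z in Set.Icc (a - δ) (b + δ),
        Set.indicator {w : Fin n → ℝ | ∀ l, 0 ≤ w l} 1 (z - x) * f z =
          MvPolynomial.eval x p := by
  have hms : MeasurableSet {w : Fin n → ℝ | ∀ l, 0 ≤ w l} := by measurability
  induction p using MvPolynomial.induction_on' with
  | monomial u r =>
    choose f hfm hfb hfi using fun i => exists_integral_Icc_eq_pow (a i) (b i) (δ i) (hδ i) (u i)
    choose K hK using hfb
    refine ⟨fun z => r * ∏ i, f i (z i), ?_, ⟨|r| * ∏ i, K i, fun z hz => ?_⟩, fun x hx => ?_⟩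
    · exact measurable_const.mul
        (Finset.measurable_fun_prod _ fun i _ => (hfm i).comp (measurable_pi_apply i))
    · rw [abs_mul, Finset.abs_prod]
      gcongr with i
      exact hK i _ ⟨hz.1 i, hz.2 i⟩
    · rw [← integral_indicator measurableSet_Icc]
      have : ∀ z, (Set.Icc (a - δ) (b + δ)).indicator (fun z =>
          Set.indicator {w : Fin n → ℝ | ∀ l, 0 ≤ w l} 1 (z - x) * (r * ∏ i, f i (z i))) z =
          r * ∏ i, (Set.Icc (x i) (b i + δ i)).indicator (f i) (z i) := by
        intro z
        by_cases h : ∀ i, z i ∈ Set.Icc (x i) (b i + δ i)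
        · rw [Set.indicator_of_mem, Set.indicator_of_mem, Pi.one_apply, one_mul]
          · congr 1
            exact Finset.prod_congr rfl fun i _ => (Set.indicator_of_mem (h i) _).symm
          · intro l
            simpa using (h l).1
          · refine ⟨fun i => ?_, fun i => (h i).2⟩
            have h1 := (h i).1
            have h2 := hx.1 i
            have h3 := hδ i
            simp only [Pi.sub_apply]
            linarith
        · push Not at h
          obtain ⟨i, hi⟩ := h
          rw [Finset.prod_eq_zero (Finset.mem_univ i) (Set.indicator_of_notMem hi _), mul_zero]
          by_cases hz : z ∈ Set.Icc (a - δ) (b + δ)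
          · rw [Set.indicator_of_mem hz, Set.indicator_of_notMem, zero_mul]
            intro hzx
            exact hi ⟨by simpa using hzx i, hz.2 i⟩
          · exact Set.indicator_of_notMem hz _
      simp_rw [this]
      rw [integral_const_mul, integral_fintype_prod_volume_eq_prod
        (fun i t => (Set.Icc (x i) (b i + δ i)).indicator (f i) t), MvPolynomial.eval_monomial,
        Finsupp.prod_fintype _ _ (by simp)]
      congr 1
      refine Finset.prod_congr rfl fun i _ => ?_
      rw [integral_indicator measurableSet_Icc, hfi i _ (hx.2 i)]
  | add p q hp hq =>
    obtain ⟨f, hfm, ⟨K, hK⟩, hf⟩ := hp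
    obtain ⟨g, hgm, ⟨L, hL⟩, hg⟩ := hq
    refine ⟨f + g, hfm.add hgm, ⟨K + L, fun z hz =>
      (abs_add_le _ _).trans (add_le_add (hK z hz) (hL z hz))⟩, fun x hx => ?_⟩
    have hint : ∀ (h : (Fin n → ℝ) → ℝ) (B : ℝ), Measurable h →
        (∀ z ∈ Set.Icc (a - δ) (b + δ), |h z| ≤ B) →
        IntegrableOn (fun z => Set.indicator {w : Fin n → ℝ | ∀ l, 0 ≤ w l} 1 (z - x) * h z)
          (Set.Icc (a - δ) (b + δ)) := by
      intro h B hm hB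
      refine IntegrableOn.of_bound isCompact_Icc.measure_lt_top ?_ B
        ((ae_restrict_iff' measurableSet_Icc).2 (.of_forall fun z hz => ?_))
      · exact (((measurable_one.indicator hms).comp (measurable_id.sub_const x)).mul
          hm).aestronglyMeasurable
      · refine le_trans ?_ (hB z hz)
        by_cases hzx : z - x ∈ {w : Fin n → ℝ | ∀ l, 0 ≤ w l} <;>
          simp only [Set.indicator_of_mem, Set.indicator_of_notMem, hzx, not_false_eq_true,
            Pi.one_apply, one_mul, zero_mul, Real.norm_eq_abs, abs_zero, abs_nonneg, le_refl]
    rw [map_add, ← hf x hx, ← hg x hx, ← integral_add (hint f K hfm hK) (hint g L hgm hL)]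
    simp [mul_add]

open scoped MatrixOrder in
/-- For a kernel `k(x, y) = ∫ N(z, x)ᵀ P N(z, y) dμ(z)` with `P` positive definite, the functions
`x ↦ ∫ N_e(z, x) f(z) dμ(z)` are uniformly approximated by combinations of kernel sections. -/
theorem exists_sum_kernel_near_integral {Ω α ι : Type*} [MeasurableSpace Ω] {μ : Measure Ω}
    [IsFiniteMeasure μ] [Fintype ι] [DecidableEq ι] {P : Matrix ι ι ℝ} (hP : P.PosDef)
    (N : Ω → α → ι → ℝ) (s : Set α) (hm : ∀ x i, Measurable fun z => N z x i)
    (C : ℝ) (hC : ∀ x ∈ s, ∀ᵐ z ∂μ, ∀ i, |N z x i| ≤ C)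
    (f : Ω → ℝ) (hfm : Measurable f) (K : ℝ) (hf : ∀ᵐ z ∂μ, |f z| ≤ K) (e : ι)
    (ε : ℝ) (hε : 0 < ε) :
    ∃ (M : ℕ) (c : Fin M → ℝ) (y : Fin M → α), (∀ j, y j ∈ s) ∧
      ∀ x ∈ s, |(∫ z, N z x e * f z ∂μ) -
        ∑ j, c j * ∫ z, N z x ⬝ᵥ P.mulVec (N z (y j)) ∂μ| ≤ ε := by
  obtain ⟨B, hB⟩ : ∃ B : Matrix ι ι ℝ, P = Bᵀ * B := by
    obtain ⟨B, hB⟩ := CStarAlgebra.nonneg_iff_eq_star_mul_self.1 hP.posSemidef.nonneg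
    exact ⟨B, by simpa [star_eq_conjTranspose, conjTranspose_eq_transpose_of_trivial] using hB⟩
  have hinner : ∀ u v : ι → ℝ, inner ℝ (WithLp.toLp 2 (B *ᵥ u)) (WithLp.toLp 2 (B *ᵥ v)) =
      u ⬝ᵥ P *ᵥ v := by
    intro u v
    rw [EuclideanSpace.inner_toLp_toLp, star_trivial, hB, ← mulVec_mulVec, dotProduct_mulVec u,
      vecMul_transpose, dotProduct_comm]
  let T : (ι → ℝ) →L[ℝ] EuclideanSpace ℝ ι :=
    LinearMap.toContinuousLinearMap
      ((WithLp.linearEquiv 2 ℝ (ι → ℝ)).symm.toLinearMap ∘ₗ B.mulVecLin)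
  have hT : ∀ (v : ι → ℝ) (D : ℝ), (∀ i, |v i| ≤ D) → ‖T v‖ ≤ ‖T‖ * |D| := fun v D hv =>
    (T.le_opNorm v).trans (mul_le_mul_of_nonneg_left
      ((pi_norm_le_iff_of_nonneg (abs_nonneg D)).2 fun i => (hv i).trans (le_abs_self D))
      (norm_nonneg T))
  have hmem : ∀ (u : Ω → ι → ℝ) (D : ℝ), (∀ i, Measurable fun z => u z i) →
      (∀ᵐ z ∂μ, ∀ i, |u z i| ≤ D) → MemLp (fun z => T (u z)) 2 μ := by
    intro u D hu hD
    refine MemLp.of_bound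
      (T.continuous.measurable.comp (measurable_pi_iff.2 hu)).aestronglyMeasurable
      (‖T‖ * |D|) ?_
    filter_upwards [hD] with z hz
    exact hT _ _ hz
  have hw : P *ᵥ (P⁻¹ *ᵥ Pi.single e 1) = Pi.single e 1 := by
    rw [mulVec_mulVec, mul_nonsing_inv _ ((isUnit_iff_isUnit_det _).1 hP.isUnit), one_mulVec]
  set w := P⁻¹ *ᵥ Pi.single e (1 : ℝ)
  have hmem₁ : ∀ x : s, MemLp (fun z => T (N z x)) 2 μ :=
    fun x => hmem _ C (hm x) (hC x x.2)
  have hmem₂ : MemLp (fun z => T (f z • w)) 2 μ := by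
    refine hmem _ (K * ‖w‖) (fun i => hfm.mul_const _) ?_
    filter_upwards [hf] with z hz i
    rw [Pi.smul_apply, smul_eq_mul, abs_mul]
    exact mul_le_mul hz (norm_le_pi_norm w i) (abs_nonneg _) ((abs_nonneg _).trans hz)
  obtain ⟨M, c, y, -, h⟩ := exists_sum_inner_feature_near (fun x => (hmem₁ x).toLp)
    Set.univ (measureUnivNNReal μ ^ (2 : ENNReal).toReal⁻¹ * (‖T‖ * |C|)) (fun x _ => by
      refine Lp.norm_le_of_ae_bound (by positivity) ?_
      filter_upwards [(hmem₁ x).coeFn_toLp, hC x x.2] with z hz hz'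
      rw [hz]
      exact hT _ _ hz') hmem₂.toLp ε hε
  refine ⟨M, c, fun j => y j, fun j => (y j).2, fun x hx => ?_⟩
  have h₁ : ∀ y : s, inner ℝ (hmem₁ ⟨x, hx⟩).toLp (hmem₁ y).toLp =
      ∫ z, N z x ⬝ᵥ P *ᵥ N z y ∂μ := by
    intro y
    rw [L2.inner_def]
    refine integral_congr_ae ?_
    filter_upwards [(hmem₁ ⟨x, hx⟩).coeFn_toLp, (hmem₁ y).coeFn_toLp] with z hz hz'
    rw [hz, hz']
    exact hinner _ _
  have h₂ : inner ℝ (hmem₁ ⟨x, hx⟩).toLp hmem₂.toLp = ∫ z, N z x e * f z ∂μ := by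
    rw [L2.inner_def]
    refine integral_congr_ae ?_
    filter_upwards [(hmem₁ ⟨x, hx⟩).coeFn_toLp, hmem₂.coeFn_toLp] with z hz hz'
    rw [hz, hz']
    refine (hinner _ _).trans ?_
    rw [mulVec_smul, hw, dotProduct_smul, dotProduct_single_one, smul_eq_mul, mul_comm]
  have := h ⟨x, hx⟩ trivial
  simp only [h₁, h₂] at this
  exact this

/-- A parametric integral of a bilinear form of bounded features is continuous, if almost every
feature function is continuous at each point. -/
theorem continuousOn_integral_bilin {Ω α ι : Type*} [MeasurableSpace Ω] {μ : Measure Ω}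
    [IsFiniteMeasure μ] [Fintype ι] [TopologicalSpace α] [FirstCountableTopology α]
    (P : Matrix ι ι ℝ) (N : Ω → α → ι → ℝ) (s : Set α)
    (hm : ∀ x i, Measurable fun z => N z x i)
    (C : ℝ) (hC : ∀ x ∈ s, ∀ᵐ z ∂μ, ∀ i, |N z x i| ≤ C)
    (hN : ∀ x, ∀ᵐ z ∂μ, ContinuousAt (N z) x) :
    ContinuousOn (fun q : α × α => ∫ z, N z q.1 ⬝ᵥ P *ᵥ N z q.2 ∂μ) (s ×ˢ s) := by
  intro q hq
  refine continuousWithinAt_of_dominated (bound := fun _ => ∑ i, ∑ j, C * (|P i j| * C))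
    (.of_forall fun q' => ?_) ?_ (integrable_const _) ?_
  · refine Measurable.aestronglyMeasurable ?_
    simp only [dotProduct, mulVec]
    exact Finset.measurable_fun_sum _ fun i _ => (hm _ i).mul
      (Finset.measurable_fun_sum _ fun j _ => (hm _ j).const_mul _)
  · filter_upwards [self_mem_nhdsWithin] with q' hq'
    filter_upwards [hC _ hq'.1, hC _ hq'.2] with z h₁ h₂
    simp only [dotProduct, mulVec, Finset.mul_sum]
    refine norm_sum_le_of_le _ fun i _ => norm_sum_le_of_le _ fun j _ => ?_
    rw [norm_mul, norm_mul]
    have hC0 : 0 ≤ C := (abs_nonneg _).trans (h₁ i)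
    exact mul_le_mul (h₁ i) (mul_le_mul_of_nonneg_left (h₂ j) (abs_nonneg _))
      (by positivity) hC0
  · filter_upwards [hN q.1, hN q.2] with z h₁ h₂
    have h₁' : ContinuousAt (fun q' : α × α => N z q'.1) q := h₁.comp continuousAt_fst
    have h₂' : ContinuousAt (fun q' : α × α => N z q'.2) q := h₂.comp continuousAt_snd
    rw [continuousAt_pi] at h₁' h₂'
    simp only [dotProduct, mulVec]
    refine ContinuousAt.continuousWithinAt ?_
    exact tendsto_finsetSum _ fun i _ => (h₁' i).mul
      (tendsto_finsetSum _ fun j _ => tendsto_const_nhds.mul (h₂' j))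

/-- For almost every `z`, the orthant indicator `x ↦ 𝟙(z - x)` is locally constant at `x`. -/
theorem ae_continuousAt_indicator_orthant {n : ℕ} (x : Fin n → ℝ) :
    ∀ᵐ z : Fin n → ℝ, ContinuousAt (fun y =>
      Set.indicator {w : Fin n → ℝ | ∀ l, 0 ≤ w l} (1 : (Fin n → ℝ) → ℝ) (z - y)) x := by
  have hne : ∀ i, ∀ᵐ z : Fin n → ℝ, z i ≠ x i := fun i => by
    rw [volume_pi]
    simpa [ae_iff] using Measure.pi_hyperplane (α := fun _ : Fin n => ℝ) (fun _ => volume) i (x i)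
  filter_upwards [ae_all_iff.2 hne] with z hz
  by_cases h : ∀ i, x i < z i
  · refine continuousAt_const.congr (f := fun _ => 1) ?_
    have : ∀ᶠ y in nhds x, ∀ i, y i < z i := Filter.eventually_all.2 fun i =>
      (continuous_apply i).continuousAt.eventually_lt continuousAt_const (h i)
    filter_upwards [this] with y hy
    rw [Set.indicator_of_mem, Pi.one_apply]
    exact fun l => by simpa using (hy l).le
  · push Not at h
    obtain ⟨i, hi⟩ := h
    refine continuousAt_const.congr (f := fun _ => 0) ?_
    have : ∀ᶠ y in nhds x, z i < y i := continuousAt_const.eventually_lt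
      (continuous_apply i).continuousAt (lt_of_le_of_ne hi (hz i))
    filter_upwards [this] with y hy
    rw [Set.indicator_of_notMem]
    intro hzy
    have := hzy i
    simp only [Pi.sub_apply] at this
    linarith

/-- universality of Tessellated Kernels with positive definite parameter: if
`P ≻ 0` then the Tessellated Kernel `k(x,y) = ∫_Y N_T^d(z,x)ᵀ P N_T^d(z,y) dz` is universal on
`X = [a,b]`. -/
theorem stmt_14 {n : ℕ} (a b δ : Fin n → ℝ) (hab : ∀ i, a i < b i) (hδ : ∀ i, 0 < δ i)
    (d nb : ℕ) (hnb : 0 < nb)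
    (η : Fin nb → (Fin n → ℕ) × (Fin n → ℕ))
    -- `η` enumerates (injectively and exhaustively) all monomials in `(z,x)` of degree ≤ d,
    -- with the constant monomial first
    (hηinj : Function.Injective η)
    (hηsurj : ∀ q : (Fin n → ℕ) × (Fin n → ℕ),
      ((∑ i, q.1 i) + (∑ i, q.2 i) ≤ d ↔ ∃ s, η s = q))
    (hη0 : η ⟨0, hnb⟩ = (0, 0))
    (NT : (Fin n → ℝ) → (Fin n → ℝ) → (Fin nb ⊕ Fin nb) → ℝ)
    (hNT : ∀ z y, NT z y = Sum.elim
      (fun t => ((∏ l, z l ^ (η t).1 l) * (∏ l, y l ^ (η t).2 l)) *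
        Set.indicator {w : Fin n → ℝ | ∀ l, 0 ≤ w l} 1 (z - y))
      (fun t => ((∏ l, z l ^ (η t).1 l) * (∏ l, y l ^ (η t).2 l)) *
        (1 - Set.indicator {w : Fin n → ℝ | ∀ l, 0 ≤ w l} 1 (z - y))))
    (P : Matrix (Fin nb ⊕ Fin nb) (Fin nb ⊕ Fin nb) ℝ) (hP : P.PosDef)
    (k : (Fin n → ℝ) → (Fin n → ℝ) → ℝ)
    (hk : ∀ x y, k x y =
      ∫ z in Set.Icc (a - δ) (b + δ), NT z x ⬝ᵥ P.mulVec (NT z y)) :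
    ContinuousOn (fun q : (Fin n → ℝ) × (Fin n → ℝ) => k q.1 q.2)
      (Set.Icc a b ×ˢ Set.Icc a b) ∧
    ∀ g : (Fin n → ℝ) → ℝ, ContinuousOn g (Set.Icc a b) →
      ∀ ε > 0, ∃ (M : ℕ) (α : Fin M → ℝ) (y : Fin M → (Fin n → ℝ)),
        (∀ j, y j ∈ Set.Icc a b) ∧
        ∀ x ∈ Set.Icc a b, |g x - ∑ j, α j * k x (y j)| ≤ ε := by
  have hms : MeasurableSet {w : Fin n → ℝ | ∀ l, 0 ≤ w l} := by measurability
  set I : (Fin n → ℝ) → ℝ := Set.indicator {w : Fin n → ℝ | ∀ l, 0 ≤ w l} 1 with hI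
  have hIm : Measurable I := measurable_one.indicator hms
  have hI01 : ∀ w, |I w| ≤ 1 ∧ |1 - I w| ≤ 1 := by
    intro w
    by_cases h : w ∈ {w : Fin n → ℝ | ∀ l, 0 ≤ w l} <;>
      simp only [hI, Set.indicator_of_mem, Set.indicator_of_notMem, h, not_false_eq_true,
        Pi.one_apply] <;> norm_num
  have hm : ∀ y i, Measurable fun z => NT z y i := by
    intro y i
    have hIy : Measurable fun z => I (z - y) := hIm.comp (measurable_id.sub_const y)
    have hmon : ∀ t, Measurable fun z : Fin n → ℝ =>
        (∏ l, z l ^ (η t).1 l) * (∏ l, y l ^ (η t).2 l) := fun t => by fun_prop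
    rcases i with t | t <;> simp only [hNT, Sum.elim_inl, Sum.elim_inr]
    · exact (hmon t).mul hIy
    · exact (hmon t).mul (measurable_const.sub hIy)
  obtain ⟨C, hC⟩ : ∃ C, ∀ z ∈ Set.Icc (a - δ) (b + δ), ∀ y ∈ Set.Icc a b, ∀ i,
      |NT z y i| ≤ C := by
    have hbd : ∀ t, ∃ C, ∀ q ∈ Set.Icc (a - δ) (b + δ) ×ˢ Set.Icc a b,
        ‖(∏ l, q.1 l ^ (η t).1 l) * (∏ l, q.2 l ^ (η t).2 l)‖ ≤ C := fun t =>
      (isCompact_Icc.prod isCompact_Icc).exists_bound_of_continuousOn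
        (Continuous.continuousOn (by fun_prop))
    choose C hC using hbd
    refine ⟨∑ t, |C t|, fun z hz y hy i => ?_⟩
    have hle : ∀ t (r : ℝ), |r| ≤ 1 →
        |(∏ l, z l ^ (η t).1 l) * (∏ l, y l ^ (η t).2 l) * r| ≤ ∑ t, |C t| := by
      intro t r hr
      rw [abs_mul]
      calc _ ≤ |(∏ l, z l ^ (η t).1 l) * (∏ l, y l ^ (η t).2 l)| * 1 := by gcongr
        _ ≤ |C t| := by
          rw [mul_one]
          exact (hC t (z, y) ⟨hz, hy⟩).trans (le_abs_self _)
        _ ≤ _ := Finset.single_le_sum (f := fun t => |C t|) (fun _ _ => abs_nonneg _)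
          (Finset.mem_univ t)
    rcases i with t | t <;> simp only [hNT, Sum.elim_inl, Sum.elim_inr]
    · exact hle t _ (hI01 _).1
    · exact hle t _ (hI01 _).2
  have : IsFiniteMeasure (volume.restrict (Set.Icc (a - δ) (b + δ))) :=
    isFiniteMeasure_restrict.2 isCompact_Icc.measure_lt_top.ne
  have hCae : ∀ y ∈ Set.Icc a b, ∀ᵐ z ∂volume.restrict (Set.Icc (a - δ) (b + δ)),
      ∀ i, |NT z y i| ≤ C := fun y hy =>
    (ae_restrict_iff' measurableSet_Icc).2 (.of_forall fun z hz => hC z hz y hy)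
  simp only [hk]
  refine ⟨continuousOn_integral_bilin P NT _ hm C hCae fun x => ?_, fun g hg ε hε => ?_⟩
  · filter_upwards [ae_restrict_of_ae (ae_continuousAt_indicator_orthant x)] with z hz
    have hmon : ∀ t, ContinuousAt (fun y : Fin n → ℝ =>
        (∏ l, z l ^ (η t).1 l) * (∏ l, y l ^ (η t).2 l)) x := fun t =>
      Continuous.continuousAt (by fun_prop)
    refine continuousAt_pi.2 fun i => ?_
    rcases i with t | t <;> simp only [hNT, Sum.elim_inl, Sum.elim_inr]
    · exact (hmon t).mul hz
    · exact (hmon t).mul (continuousAt_const.sub hz)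
  · obtain ⟨p, hp⟩ := exists_mvPolynomial_near_of_continuousOn isCompact_Icc hg (half_pos hε)
    obtain ⟨f, hfm, ⟨K, hK⟩, hf⟩ := exists_integral_orthant_eq_eval a b δ hδ p
    obtain ⟨M, c, y, hy, h⟩ := exists_sum_kernel_near_integral hP NT (Set.Icc a b) hm C hCae f hfm K
      ((ae_restrict_iff' measurableSet_Icc).2 (.of_forall hK)) (Sum.inl ⟨0, hnb⟩) _ (half_pos hε)
    refine ⟨M, c, y, hy, fun x hx => ?_⟩
    have h₁ : ∀ z, NT z x (Sum.inl ⟨0, hnb⟩) = I (z - x) := fun z => by simp [hNT, hη0]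
    have h₂ := h x hx
    simp only [h₁] at h₂
    rw [hf x hx] at h₂
    calc _ ≤ _ := abs_sub_le _ (MvPolynomial.eval x p) _
      _ ≤ ε / 2 + ε / 2 := add_le_add (hp x hx) h₂
      _ = ε := add_halves ε
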